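/- For every n and k with 2 ≤ k ≤ n, every step size α ∈ ℝ, discount γ ∈ ℝ, reward r ∈ ℝ, next-feature vector φ' ∈ ℝⁿ with φ'ᵢ = 0 for all i < k, and every initial weight vector θ ∈ ℝⁿ with θᵢ = c for all i < k, there exists a single transition tuple (φ̃, r̃, φ') with φ̃ ∈ ℝⁿ, r̃ ∈ ℝ, and φ̃ ≠ eᵢ for every i < n, such that one TD(0) semi-gradient update of θ on (φ̃, r̃, φ') with step size α produces exactly the weight vector obtained by k successive TD(0) updates of θ with step size α on the environment transitions (e₀, r, φ'), …, (e_{k−1}, r, φ') applied in order. -/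

import Mathlib

open Matrix

/-- The TD(0) semi-gradient update with step size `α` and discount `γ` of weights `θ`
on the transition tuple `(φ, r, φ')`: `θ ← θ + α·(r + γ⟨θ,φ'⟩ − ⟨θ,φ⟩)·φ`. -/
def tdUpdate {n : ℕ} (α γ : ℝ) (θ φ : Fin n → ℝ) (r : ℝ) (φ' : Fin n → ℝ) :
    Fin n → ℝ :=
  θ + (α * (r + γ * (θ ⬝ᵥ φ') - θ ⬝ᵥ φ)) • φ

/-- The `j`-th standard basis (one-hot) vector of `ℝⁿ`, indexed by a natural `j`. -/
def oneHot (n : ℕ) (j : ℕ) : Fin n → ℝ :=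
  fun i => if (i : ℕ) = j then 1 else 0

/-- The result of `j` successive TD(0) updates of `θ`, the `l`-th (for `l = 0, …, j−1`,
applied in order) on the environment transition `(e_l, r, φ')`. -/
def tdIter {n : ℕ} (α γ : ℝ) (r : ℝ) (φ' : Fin n → ℝ) (θ : Fin n → ℝ) :
    ℕ → (Fin n → ℝ)
  | 0 => θ
  | j + 1 => tdUpdate α γ (tdIter α γ r φ' θ j) (oneHot n j) r φ'

/-- The indicator vector of the first `j` coordinates of `ℝⁿ`. -/
def initialIndicator (n j : ℕ) : Fin n → ℝ :=
  fun i => if (i : ℕ) < j then 1 else 0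

lemma initialIndicator_zero (n : ℕ) : initialIndicator n 0 = 0 := by
  ext i
  simp [initialIndicator]

lemma initialIndicator_succ (n j : ℕ) :
    initialIndicator n (j + 1) = initialIndicator n j + oneHot n j := by
  ext i
  simp only [initialIndicator, oneHot, Pi.add_apply]
  split_ifs <;> first | omega | norm_num

lemma initialIndicator_ne_oneHot {n k : ℕ} (hk2 : 2 ≤ k) (hkn : k ≤ n) (i : ℕ) :
    initialIndicator n k ≠ oneHot n i := by
  intro h
  have h0 := congrFun h ⟨0, by omega⟩
  have h1 := congrFun h ⟨1, by omega⟩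
  simp only [initialIndicator, oneHot] at h0 h1
  grind

lemma dotProduct_oneHot {n j : ℕ} (hj : j < n) (v : Fin n → ℝ) :
    v ⬝ᵥ oneHot n j = v ⟨j, hj⟩ := by
  have h : oneHot n j = Pi.single ⟨j, hj⟩ 1 := by
    ext i
    simp [oneHot, Pi.single_apply, Fin.ext_iff]
  rw [h, dotProduct_single_one]

lemma initialIndicator_dotProduct_eq_zero {n j : ℕ} {v : Fin n → ℝ}
    (hv : ∀ i : Fin n, (i : ℕ) < j → v i = 0) : initialIndicator n j ⬝ᵥ v = 0 := by
  refine Finset.sum_eq_zero fun i _ => ?_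
  by_cases hi : (i : ℕ) < j <;> simp [initialIndicator, hi, hv]

/-- As long as the visited states share the value `c` and the next feature vanishes on them,
successive updates all have the same TD error. -/
lemma tdIter_eq_add_smul_initialIndicator {n : ℕ} (α γ r c : ℝ) (φ' θ : Fin n → ℝ) {j : ℕ}
    (hjn : j ≤ n) (hφ' : ∀ i : Fin n, (i : ℕ) < j → φ' i = 0)
    (hθ : ∀ i : Fin n, (i : ℕ) < j → θ i = c) :
    tdIter α γ r φ' θ j =
      θ + (α * (r + γ * (θ ⬝ᵥ φ') - c)) • initialIndicator n j := by
  induction j with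
  | zero => simp [tdIter, initialIndicator_zero]
  | succ j ih =>
    have hφ'j : ∀ i : Fin n, (i : ℕ) < j → φ' i = 0 := fun i hi => hφ' i (by omega)
    rw [tdIter, ih (by omega) hφ'j fun i hi => hθ i (by omega), tdUpdate, add_dotProduct,
      smul_dotProduct, initialIndicator_dotProduct_eq_zero hφ'j, dotProduct_oneHot hjn,
      initialIndicator_succ]
    simp [hθ ⟨j, hjn⟩ (Nat.lt_succ_self j), initialIndicator, add_assoc]

/-- There is a single synthetic transition `(φ̃, r̃, φ')` whose feature
`φ̃` is not any one-hot vector `eᵢ` (`i < n`), such that one TD(0) update of `θ` on it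
produces exactly the weight vector obtained by `k` successive TD(0) updates of `θ` on
the environment transitions `(e₀, r, φ'), …, (e_{k−1}, r, φ')` applied in order. -/
theorem stmt_5 (n k : ℕ) (hk2 : 2 ≤ k) (hkn : k ≤ n)
    (α γ r c : ℝ) (φ' : Fin n → ℝ) (hφ' : ∀ i : Fin n, (i : ℕ) < k → φ' i = 0)
    (θ : Fin n → ℝ) (hθ : ∀ i : Fin n, (i : ℕ) < k → θ i = c) :
    ∃ (φtilde : Fin n → ℝ) (rtilde : ℝ),
      (∀ i : ℕ, i < n → φtilde ≠ oneHot n i) ∧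
      tdUpdate α γ θ φtilde rtilde φ' = tdIter α γ r φ' θ k := by
  refine ⟨initialIndicator n k, r - c + θ ⬝ᵥ initialIndicator n k,
    fun i _ => initialIndicator_ne_oneHot hk2 hkn i, ?_⟩
  rw [tdIter_eq_add_smul_initialIndicator α γ r c φ' θ hkn hφ' hθ, tdUpdate]
  congr 3
  ring
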